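/- Let a, d be real constants and define on ℝ³ × ℝ the velocity field u₁(x,y,z,t) = −a[e^{ax} sin(ay+dz) + e^{az} cos(ax+dy)] e^{−d²t}, u₂(x,y,z,t) = −a[e^{ay} sin(az+dx) + e^{ax} cos(ay+dz)] e^{−d²t}, u₃(x,y,z,t) = −a[e^{az} sin(ax+dy) + e^{ay} cos(az+dx)] e^{−d²t}, and the pressure p(x,y,z,t) = −½ a² [e^{2ax} + e^{2ay} + e^{2az} + 2 sin(ax+dy) cos(az+dx) e^{a(y+z)} + 2 sin(ay+dz) cos(ax+dy) e^{a(z+x)} + 2 sin(az+dx) cos(ay+dz) e^{a(x+y)}] e^{−2d²t}. Then the nonlinear convection term is exactly balanced by the pressure gradient: for each component i ∈ {1,2,3}, u₁ ∂uᵢ/∂x + u₂ ∂uᵢ/∂y + u₃ ∂uᵢ/∂z + ∂p/∂xᵢ = 0 at every point (x,y,z,t). -/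

import Mathlib

open Real

/-- First component of the spatial profile of the Ethier–Steinman velocity field; the other two
are obtained by cyclic permutation of the coordinates. -/
noncomputable def ethierSteinmanVelocity (a d x y z : ℝ) : ℝ :=
  exp (a * x) * sin (a * y + d * z) + exp (a * z) * cos (a * x + d * y)

/-- Spatial profile of the Ethier–Steinman pressure, up to the factor `-a ^ 2 / 2`. -/
noncomputable def ethierSteinmanPressure (a d x y z : ℝ) : ℝ :=
  exp (2 * a * x) + exp (2 * a * y) + exp (2 * a * z)
    + 2 * sin (a * x + d * y) * cos (a * z + d * x) * exp (a * (y + z))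
    + 2 * sin (a * y + d * z) * cos (a * x + d * y) * exp (a * (z + x))
    + 2 * sin (a * z + d * x) * cos (a * y + d * z) * exp (a * (x + y))

theorem hasDerivAt_mul_add_const (k c x : ℝ) : HasDerivAt (fun s => k * s + c) k x := by
  simpa using ((hasDerivAt_id x).const_mul k).add_const c

theorem hasDerivAt_const_add_mul (k c x : ℝ) : HasDerivAt (fun s => c + k * s) k x := by
  simpa using ((hasDerivAt_id x).const_mul k).const_add c

theorem hasDerivAt_const_mul_id (k x : ℝ) : HasDerivAt (fun s => k * s) k x := by
  simpa using (hasDerivAt_id x).const_mul k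

theorem hasDerivAt_ethierSteinmanVelocity_fst (a d x y z : ℝ) :
    HasDerivAt (fun s => ethierSteinmanVelocity a d s y z)
      (a * exp (a * x) * sin (a * y + d * z) - a * exp (a * z) * sin (a * x + d * y)) x := by
  unfold ethierSteinmanVelocity
  refine HasDerivAt.congr_deriv
    (((hasDerivAt_const_mul_id a x).exp.mul_const (sin (a * y + d * z))).fun_add
    ((hasDerivAt_mul_add_const a (d * y) x).cos.const_mul (exp (a * z)))) ?_
  ring

theorem hasDerivAt_ethierSteinmanVelocity_snd (a d x y z : ℝ) :
    HasDerivAt (fun s => ethierSteinmanVelocity a d x s z)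
      (a * exp (a * x) * cos (a * y + d * z) - d * exp (a * z) * sin (a * x + d * y)) y := by
  unfold ethierSteinmanVelocity
  refine HasDerivAt.congr_deriv
    (((hasDerivAt_mul_add_const a (d * z) y).sin.const_mul (exp (a * x))).fun_add
    ((hasDerivAt_const_add_mul d (a * x) y).cos.const_mul (exp (a * z)))) ?_
  ring

theorem hasDerivAt_ethierSteinmanVelocity_thd (a d x y z : ℝ) :
    HasDerivAt (fun s => ethierSteinmanVelocity a d x y s)
      (d * exp (a * x) * cos (a * y + d * z) + a * exp (a * z) * cos (a * x + d * y)) z := by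
  unfold ethierSteinmanVelocity
  refine HasDerivAt.congr_deriv
    (((hasDerivAt_const_add_mul d (a * y) z).sin.const_mul (exp (a * x))).fun_add
    ((hasDerivAt_const_mul_id a z).exp.mul_const (cos (a * x + d * y)))) ?_
  ring

theorem ethierSteinmanPressure_cyclic (a d x y z : ℝ) :
    ethierSteinmanPressure a d y z x = ethierSteinmanPressure a d x y z := by
  unfold ethierSteinmanPressure
  ring

/-- The pressure profile is the squared length of the velocity profile. -/
theorem ethierSteinmanPressure_eq_sum_sq (a d x y z : ℝ) :
    ethierSteinmanPressure a d x y z = ethierSteinmanVelocity a d x y z ^ 2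
      + ethierSteinmanVelocity a d y z x ^ 2 + ethierSteinmanVelocity a d z x y ^ 2 := by
  unfold ethierSteinmanPressure ethierSteinmanVelocity
  have hsq (w : ℝ) : exp (2 * a * w) = exp (a * w) ^ 2 := by
    rw [← exp_nat_mul]; congr 1; push_cast; ring
  simp only [hsq, mul_add a, exp_add]
  linear_combination
    -exp (a * x) ^ 2 * sin_sq_add_cos_sq (a * y + d * z)
      - exp (a * y) ^ 2 * sin_sq_add_cos_sq (a * z + d * x)
      - exp (a * z) ^ 2 * sin_sq_add_cos_sq (a * x + d * y)

/-- First component of the balance; the field is Beltrami, so `(u·∇)u = ∇(|u|² / 2)`. -/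
theorem ethierSteinman_balance_fst (a d E F x y z : ℝ) (hF : F = E ^ 2) :
    (-a * ethierSteinmanVelocity a d x y z * E)
        * deriv (fun s => -a * ethierSteinmanVelocity a d s y z * E) x
      + (-a * ethierSteinmanVelocity a d y z x * E)
        * deriv (fun s => -a * ethierSteinmanVelocity a d x s z * E) y
      + (-a * ethierSteinmanVelocity a d z x y * E)
        * deriv (fun s => -a * ethierSteinmanVelocity a d x y s * E) z
      + deriv (fun s => -(1 / 2) * a ^ 2 * ethierSteinmanPressure a d s y z * F) x = 0 := by
  have hx := hasDerivAt_ethierSteinmanVelocity_fst a d x y z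
  have hp := ((hx.fun_pow 2).fun_add
    ((hasDerivAt_ethierSteinmanVelocity_thd a d y z x).fun_pow 2)).fun_add
    ((hasDerivAt_ethierSteinmanVelocity_snd a d z x y).fun_pow 2)
  simp only [← ethierSteinmanPressure_eq_sum_sq] at hp
  rw [((hx.const_mul (-a)).mul_const E).deriv,
    (((hasDerivAt_ethierSteinmanVelocity_snd a d x y z).const_mul (-a)).mul_const E).deriv,
    (((hasDerivAt_ethierSteinmanVelocity_thd a d x y z).const_mul (-a)).mul_const E).deriv,
    ((hp.const_mul (-(1 / 2) * a ^ 2)).mul_const F).deriv, hF]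
  simp only [ethierSteinmanVelocity]
  push_cast
  ring

/-- For the Ethier–Steinman-type exact solution, the nonlinear convection term is exactly
balanced by the pressure gradient: for each component `i`,
`u₁ ∂uᵢ/∂x + u₂ ∂uᵢ/∂y + u₃ ∂uᵢ/∂z + ∂p/∂xᵢ = 0` at every point `(x,y,z,t)`. -/
theorem ethier_steinman_convection_pressure_balance
    (a d : ℝ) (u₁ u₂ u₃ p : ℝ → ℝ → ℝ → ℝ → ℝ)
    (hu₁ : ∀ x y z t, u₁ x y z t =
      -a * (Real.exp (a * x) * Real.sin (a * y + d * z)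
            + Real.exp (a * z) * Real.cos (a * x + d * y)) * Real.exp (-d ^ 2 * t))
    (hu₂ : ∀ x y z t, u₂ x y z t =
      -a * (Real.exp (a * y) * Real.sin (a * z + d * x)
            + Real.exp (a * x) * Real.cos (a * y + d * z)) * Real.exp (-d ^ 2 * t))
    (hu₃ : ∀ x y z t, u₃ x y z t =
      -a * (Real.exp (a * z) * Real.sin (a * x + d * y)
            + Real.exp (a * y) * Real.cos (a * z + d * x)) * Real.exp (-d ^ 2 * t))
    (hp : ∀ x y z t, p x y z t =
      -(1 / 2) * a ^ 2 *
        (Real.exp (2 * a * x) + Real.exp (2 * a * y) + Real.exp (2 * a * z)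
          + 2 * Real.sin (a * x + d * y) * Real.cos (a * z + d * x) * Real.exp (a * (y + z))
          + 2 * Real.sin (a * y + d * z) * Real.cos (a * x + d * y) * Real.exp (a * (z + x))
          + 2 * Real.sin (a * z + d * x) * Real.cos (a * y + d * z) * Real.exp (a * (x + y)))
        * Real.exp (-2 * d ^ 2 * t)) :
    ∀ x y z t : ℝ,
      (u₁ x y z t * deriv (fun s => u₁ s y z t) x
        + u₂ x y z t * deriv (fun s => u₁ x s z t) y
        + u₃ x y z t * deriv (fun s => u₁ x y s t) z
        + deriv (fun s => p s y z t) x = 0)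
      ∧
      (u₁ x y z t * deriv (fun s => u₂ s y z t) x
        + u₂ x y z t * deriv (fun s => u₂ x s z t) y
        + u₃ x y z t * deriv (fun s => u₂ x y s t) z
        + deriv (fun s => p x s z t) y = 0)
      ∧
      (u₁ x y z t * deriv (fun s => u₃ s y z t) x
        + u₂ x y z t * deriv (fun s => u₃ x s z t) y
        + u₃ x y z t * deriv (fun s => u₃ x y s t) z
        + deriv (fun s => p x y s t) z = 0) := by
  intro x y z t
  have hF : exp (-2 * d ^ 2 * t) = exp (-d ^ 2 * t) ^ 2 := by
    rw [← exp_nat_mul]; congr 1; push_cast; ring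
  replace hu₁ (x y z t) :
      u₁ x y z t = -a * ethierSteinmanVelocity a d x y z * exp (-d ^ 2 * t) := hu₁ x y z t
  replace hu₂ (x y z t) :
      u₂ x y z t = -a * ethierSteinmanVelocity a d y z x * exp (-d ^ 2 * t) := hu₂ x y z t
  replace hu₃ (x y z t) :
      u₃ x y z t = -a * ethierSteinmanVelocity a d z x y * exp (-d ^ 2 * t) := hu₃ x y z t
  replace hp (x y z t) : p x y z t =
      -(1 / 2) * a ^ 2 * ethierSteinmanPressure a d x y z * exp (-2 * d ^ 2 * t) := hp x y z t
  simp only [hu₁, hu₂, hu₃, hp]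
  refine ⟨ethierSteinman_balance_fst a d _ _ x y z hF, ?_, ?_⟩
  · have h := ethierSteinman_balance_fst a d _ _ y z x hF
    simp only [ethierSteinmanPressure_cyclic a d x] at h
    linear_combination h
  · have h := ethierSteinman_balance_fst a d _ _ z x y hF
    have hc (s : ℝ) : ethierSteinmanPressure a d s x y = ethierSteinmanPressure a d x y s :=
      (ethierSteinmanPressure_cyclic a d s x y).symm
    simp only [hc] at h
    linear_combination h
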